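/- Let 𝐗 = (X,𝕏) be a level-2 α-Hölder rough path over V, let 𝐘 = (Y,Y') be an 𝐗-controlled rough path with values in L(W,U) and let 𝐙 = (Z,Z') be an 𝐗-controlled rough path with values in W. Then for all 0 ≤ s ≤ t ≤ T the rough integral satisfies the a priori bound ‖∫_s^t Y dZ − Y_s(Z_{s,t}) − (Y'_s ⋆ Z'_s)(𝕏_{s,t})‖ ≤ C_α (‖Y'_0‖ + ‖𝐘‖_{𝐗;α}) (‖Z'_0‖ + ‖𝐙‖_{𝐗;α}) (1 + ‖𝐗‖_α)² (t − s)^{3α}. -/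

import Mathlib

/-!  Common definitions: level-2 rough paths, controlled rough paths,
compensated Riemann sums and rough integrals of a controlled rough path
against another controlled rough path. -/

open scoped BigOperators

noncomputable section

/-- `HBound T β A` : the two-parameter map `A` satisfies a `β`-Hölder bound on the
simplex `{0 ≤ s < t ≤ T}`. -/
def HBound {E : Type*} [NormedAddCommGroup E] (T β : ℝ) (A : ℝ → ℝ → E) : Prop :=
  ∃ C : ℝ, ∀ s t : ℝ, 0 ≤ s → s < t → t ≤ T → ‖A s t‖ ≤ C * (t - s) ^ β

/-- The Hölder seminorm `‖A‖_β = sup_{0 ≤ s < t ≤ T} ‖A_{s,t}‖ / (t-s)^β`, realised as the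
least admissible Hölder constant. -/
def hnorm {E : Type*} [NormedAddCommGroup E] (T β : ℝ) (A : ℝ → ℝ → E) : ℝ :=
  sInf {C : ℝ | 0 ≤ C ∧ ∀ s t : ℝ, 0 ≤ s → s < t → t ≤ T → ‖A s t‖ ≤ C * (t - s) ^ β}

/-- An abstract model of the projective tensor product `V ⊗̂ V`, bundling the canonical
bounded bilinear map `tmul : V × V → V ⊗̂ V` and the pairing `⋆` sending
`A ∈ L(V, L(W,U))` and `B ∈ L(V,W)` to the induced operator `A ⋆ B ∈ L(V ⊗̂ V, U)`,
characterised by `(A ⋆ B)(v₁ ⊗ v₂) = (A v₁)(B v₂)` and `‖A ⋆ B‖ ≤ ‖A‖ ‖B‖`. -/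
structure TensorOps (V V2 W U : Type*)
    [NormedAddCommGroup V] [NormedSpace ℝ V] [NormedAddCommGroup V2] [NormedSpace ℝ V2]
    [NormedAddCommGroup W] [NormedSpace ℝ W] [NormedAddCommGroup U] [NormedSpace ℝ U] where
  tmul : V →L[ℝ] V →L[ℝ] V2
  tmul_le : ∀ a b : V, ‖tmul a b‖ ≤ ‖a‖ * ‖b‖
  spair : (V →L[ℝ] (W →L[ℝ] U)) →L[ℝ] ((V →L[ℝ] W) →L[ℝ] (V2 →L[ℝ] U))
  spair_tmul : ∀ (A : V →L[ℝ] (W →L[ℝ] U)) (B : V →L[ℝ] W) (a b : V),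
    spair A B (tmul a b) = (A a) (B b)
  spair_le : ∀ (A : V →L[ℝ] (W →L[ℝ] U)) (B : V →L[ℝ] W), ‖spair A B‖ ≤ ‖A‖ * ‖B‖

section Defs

variable {V V2 E : Type*}
  [NormedAddCommGroup V] [NormedSpace ℝ V] [NormedAddCommGroup V2] [NormedSpace ℝ V2]
  [NormedAddCommGroup E] [NormedSpace ℝ E]

/-- `(X, XX)` is a level-2 `α`-Hölder rough path on `[0,T]`:
Chen's relation plus the analytic estimates. -/
structure IsRoughPath (T α : ℝ) (tmul : V →L[ℝ] V →L[ℝ] V2)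
    (X : ℝ → V) (XX : ℝ → ℝ → V2) : Prop where
  chen : ∀ s u t : ℝ, 0 ≤ s → s ≤ u → u ≤ t → t ≤ T →
    XX s t = XX s u + XX u t + tmul (X u - X s) (X t - X u)
  x_hold : HBound T α fun s t => X t - X s
  xx_hold : HBound T (2 * α) XX

/-- `‖𝐗‖_α := ‖X‖_α + ‖𝕏‖_{2α}`. -/
def rpNorm (T α : ℝ) (X : ℝ → V) (XX : ℝ → ℝ → V2) : ℝ :=
  hnorm T α (fun s t => X t - X s) + hnorm T (2 * α) XX

/-- `‖𝐗 − 𝐗̃‖_α := ‖X − X̃‖_α + ‖𝕏 − 𝕏̃‖_{2α}`. -/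
def rpDist (T α : ℝ) (X Xt : ℝ → V) (XX XXt : ℝ → ℝ → V2) : ℝ :=
  hnorm T α (fun s t => (X t - X s) - (Xt t - Xt s)) +
    hnorm T (2 * α) fun s t => XX s t - XXt s t

/-- The remainder `R^{𝐘}_{s,t} := Y_{s,t} − Y'_s(X_{s,t})` of a controlled rough path. -/
def Rem (X : ℝ → V) (Y : ℝ → E) (Y' : ℝ → V →L[ℝ] E) (s t : ℝ) : E :=
  Y t - Y s - Y' s (X t - X s)

/-- `(Y, Y')` is an `𝐗`-controlled rough path on `[0,T]` with values in `E`. -/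
structure IsCRP (T α : ℝ) (X : ℝ → V) (Y : ℝ → E) (Y' : ℝ → V →L[ℝ] E) : Prop where
  deriv_hold : HBound T α fun s t => Y' t - Y' s
  rem_hold : HBound T (2 * α) (Rem X Y Y')

/-- `‖𝐘‖_{𝐗;α} := ‖R^{𝐘}‖_{2α} + ‖Y'‖_α`. -/
def crpNorm (T α : ℝ) (X : ℝ → V) (Y : ℝ → E) (Y' : ℝ → V →L[ℝ] E) : ℝ :=
  hnorm T (2 * α) (Rem X Y Y') + hnorm T α fun s t => Y' t - Y' s

/-- `d_{𝐗,𝐗̃;α}(𝐘,𝐘̃) := ‖R^{𝐘} − R^{𝐘̃}‖_{2α} + ‖Y' − Ỹ'‖_α`. -/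
def crpDist (T α : ℝ) (X Xt : ℝ → V) (Y : ℝ → E) (Y' : ℝ → V →L[ℝ] E)
    (Yt : ℝ → E) (Yt' : ℝ → V →L[ℝ] E) : ℝ :=
  hnorm T (2 * α) (fun s t => Rem X Y Y' s t - Rem Xt Yt Yt' s t) +
    hnorm T α fun s t => (Y' t - Y' s) - (Yt' t - Yt' s)

/-- `p` is a finite partition `s = p 0 < p 1 < ⋯ < p n = t` of `[s,t]`. -/
def IsPartition (s t : ℝ) (n : ℕ) (p : ℕ → ℝ) : Prop :=
  p 0 = s ∧ p n = t ∧ ∀ i < n, p i < p (i + 1)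

end Defs

section Sums

variable {V V2 W U : Type*}
  [NormedAddCommGroup V] [NormedSpace ℝ V] [NormedAddCommGroup V2] [NormedSpace ℝ V2]
  [NormedAddCommGroup W] [NormedSpace ℝ W] [NormedAddCommGroup U] [NormedSpace ℝ U]

/-- The compensated Riemann sum
`∫_P Y dZ := Σ_i [ Y_{t_i}(Z_{t_i,t_{i+1}}) + (Y'_{t_i} ⋆ Z'_{t_i})(𝕏_{t_i,t_{i+1}}) ]`. -/
def rsum (tops : TensorOps V V2 W U) (XX : ℝ → ℝ → V2)
    (Y : ℝ → W →L[ℝ] U) (Y' : ℝ → V →L[ℝ] (W →L[ℝ] U))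
    (Z : ℝ → W) (Z' : ℝ → V →L[ℝ] W) (n : ℕ) (p : ℕ → ℝ) : U :=
  ∑ i ∈ Finset.range n,
    ((Y (p i)) (Z (p (i + 1)) - Z (p i)) +
      (tops.spair (Y' (p i)) (Z' (p i))) (XX (p i) (p (i + 1))))

/-- `I` is the rough integral `∫_s^t Y dZ`: the limit of the compensated Riemann sums
as the mesh of the partition tends to `0`. -/
def IsRoughIntegral (tops : TensorOps V V2 W U) (XX : ℝ → ℝ → V2)
    (Y : ℝ → W →L[ℝ] U) (Y' : ℝ → V →L[ℝ] (W →L[ℝ] U))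
    (Z : ℝ → W) (Z' : ℝ → V →L[ℝ] W) (s t : ℝ) (I : U) : Prop :=
  ∀ ε : ℝ, 0 < ε → ∃ δ : ℝ, 0 < δ ∧ ∀ (n : ℕ) (p : ℕ → ℝ), IsPartition s t n p →
    (∀ i < n, p (i + 1) - p i < δ) → ‖rsum tops XX Y Y' Z Z' n p - I‖ ≤ ε

end Sums

/-- The constant `C_α := (1 + T^α + T^{2α}) · 2^{3α} · Σ_{n≥1} n^{-3α}`. -/
def Calpha (T α : ℝ) : ℝ :=
  (1 + T ^ α + T ^ (2 * α)) * (2 : ℝ) ^ (3 * α) * ∑' n : ℕ, ((n : ℝ) + 1) ^ (-(3 * α))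

/-- `F ∈ C_b^k`: `k` times continuously Fréchet differentiable with all derivatives
up to order `k` bounded. -/
def IsCb {E₁ E₂ : Type*} [NormedAddCommGroup E₁] [NormedSpace ℝ E₁]
    [NormedAddCommGroup E₂] [NormedSpace ℝ E₂] (k : ℕ) (F : E₁ → E₂) : Prop :=
  ContDiff ℝ (k : ℕ∞) F ∧ ∀ j ≤ k, ∃ C : ℝ, ∀ x, ‖iteratedFDeriv ℝ j F x‖ ≤ C

/-- `‖F‖_{C_b^k} := Σ_{j=0}^k sup_x ‖D^j F(x)‖`. -/
def cbNorm {E₁ E₂ : Type*} [NormedAddCommGroup E₁] [NormedSpace ℝ E₁]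
    [NormedAddCommGroup E₂] [NormedSpace ℝ E₂] (k : ℕ) (F : E₁ → E₂) : ℝ :=
  ∑ j ∈ Finset.range (k + 1), ⨆ x : E₁, ‖iteratedFDeriv ℝ j F x‖

end

theorem hnorm_nonneg {E : Type*} [NormedAddCommGroup E] (T β : ℝ) (A : ℝ → ℝ → E) :
    0 ≤ hnorm T β A :=
  Real.sInf_nonneg fun _ h => h.1

theorem HBound.le_hnorm {E : Type*} [NormedAddCommGroup E] {T β : ℝ} {A : ℝ → ℝ → E}
    (h : HBound T β A) {s t : ℝ} (hs : 0 ≤ s) (hst : s < t) (ht : t ≤ T) :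
    ‖A s t‖ ≤ hnorm T β A * (t - s) ^ β := by
  have hpos : 0 < (t - s) ^ β := Real.rpow_pos_of_pos (sub_pos.2 hst) β
  rw [← div_le_iff₀ hpos]
  obtain ⟨C, hC⟩ := h
  refine le_csInf ⟨max C 0, le_max_right _ _, fun a b ha hab hb => (hC a b ha hab hb).trans ?_⟩ ?_
  · exact mul_le_mul_of_nonneg_right (le_max_left _ _) (Real.rpow_nonneg (sub_pos.2 hab).le _)
  · rintro D ⟨-, hD⟩
    rw [div_le_iff₀ hpos]
    exact hD s t hs hst ht

theorem IsPartition.le {s t : ℝ} {n : ℕ} {p : ℕ → ℝ} (hp : IsPartition s t n p) {i j : ℕ}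
    (hij : i ≤ j) (hj : j ≤ n) : p i ≤ p j := by
  induction j, hij using Nat.le_induction with
  | base => exact le_rfl
  | succ k _ ih => exact (ih (by omega)).trans (hp.2.2 k (by omega)).le

/-- The sequence `p` with its term of index `j + 1` left out. -/
def dropPoint (p : ℕ → ℝ) (j i : ℕ) : ℝ := if i ≤ j then p i else p (i + 1)

theorem IsPartition.dropPoint {s t : ℝ} {n : ℕ} {p : ℕ → ℝ} (hp : IsPartition s t (n + 1) p)
    {j : ℕ} (hj : j < n) : IsPartition s t n (dropPoint p j) := by
  refine ⟨?_, ?_, fun i hi => ?_⟩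
  · simpa [_root_.dropPoint] using hp.1
  · simpa [_root_.dropPoint, not_le.2 hj] using hp.2.1
  · simp only [_root_.dropPoint]
    split_ifs with h1 h2 h2
    · exact hp.2.2 i (by omega)
    · exact (hp.2.2 i (by omega)).trans (hp.2.2 (i + 1) (by omega))
    · omega
    · exact hp.2.2 (i + 1) (by omega)

theorem sum_dropPoint {U : Type*} [AddCommGroup U] (Ξ : ℝ → ℝ → U) (p : ℕ → ℝ) {n j : ℕ}
    (hj : j < n) :
    ∑ i ∈ Finset.range n, Ξ (dropPoint p j i) (dropPoint p j (i + 1)) =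
      ∑ i ∈ Finset.range (n + 1), Ξ (p i) (p (i + 1)) +
        (Ξ (p j) (p (j + 2)) - Ξ (p j) (p (j + 1)) - Ξ (p (j + 1)) (p (j + 2))) := by
  obtain ⟨m, rfl⟩ : ∃ m, n = j + 1 + m := ⟨n - (j + 1), by omega⟩
  rw [show j + 1 + m + 1 = j + 1 + 1 + m by omega, Finset.sum_range_add _ (j + 1) m,
    Finset.sum_range_add _ (j + 1 + 1) m, Finset.sum_range_succ _ (j + 1),
    Finset.sum_range_succ _ j, Finset.sum_range_succ _ j]
  have h1 : ∑ i ∈ Finset.range j, Ξ (dropPoint p j i) (dropPoint p j (i + 1)) =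
      ∑ i ∈ Finset.range j, Ξ (p i) (p (i + 1)) := by
    refine Finset.sum_congr rfl fun i hi => ?_
    rw [Finset.mem_range] at hi
    rw [dropPoint, dropPoint, if_pos hi.le, if_pos (by omega)]
  have h2 : ∑ i ∈ Finset.range m, Ξ (dropPoint p j (j + 1 + i)) (dropPoint p j (j + 1 + i + 1)) =
      ∑ i ∈ Finset.range m, Ξ (p (j + 1 + 1 + i)) (p (j + 1 + 1 + i + 1)) := by
    refine Finset.sum_congr rfl fun i _ => ?_
    rw [dropPoint, dropPoint, if_neg (by omega), if_neg (by omega)]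
    congr 2 <;> omega
  have h3 : Ξ (dropPoint p j j) (dropPoint p j (j + 1)) = Ξ (p j) (p (j + 2)) := by
    simp [dropPoint]
  rw [h1, h2, h3]
  abel

theorem IsPartition.exists_short {s t : ℝ} {n : ℕ} {p : ℕ → ℝ}
    (hp : IsPartition s t (n + 2) p) :
    ∃ j < n + 1, p (j + 2) - p j ≤ 2 * (t - s) / (n + 1) := by
  have hsum : ∑ j ∈ Finset.range (n + 1), (p (j + 2) - p j) ≤
      ∑ _j ∈ Finset.range (n + 1), 2 * (t - s) / ((n : ℝ) + 1) := by
    have h : ∑ j ∈ Finset.range (n + 1), (p (j + 2) - p j) =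
        (p (n + 2) - p 1) + (p (n + 1) - p 0) := by
      rw [← Finset.sum_range_sub p (n + 1), ← Finset.sum_range_sub (fun i => p (i + 1)) (n + 1),
        ← Finset.sum_add_distrib]
      exact Finset.sum_congr rfl fun i _ => by ring
    rw [h, Finset.sum_const, Finset.card_range, nsmul_eq_mul]
    have h1 := hp.le (i := 0) (j := 1) (by omega) (by omega)
    have h2 := hp.le (i := n + 1) (j := n + 2) (by omega) le_rfl
    have h3 := hp.1
    have h4 := hp.2.1
    push_cast
    rw [mul_div_cancel₀ _ (by positivity)]
    linarith
  obtain ⟨j, hj, h⟩ := Finset.exists_le_of_sum_le (by simp) hsum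
  exact ⟨j, Finset.mem_range.1 hj, h⟩

/-- Young's maximal inequality for sums of an almost additive two-parameter map. -/
theorem norm_partition_sum_sub_le {U : Type*} [NormedAddCommGroup U] {Ξ : ℝ → ℝ → U}
    {s t K γ : ℝ} (hK : 0 ≤ K) (hγ : 0 ≤ γ)
    (hΞ : ∀ a b c, s ≤ a → a < b → b < c → c ≤ t →
      ‖Ξ a c - Ξ a b - Ξ b c‖ ≤ K * (c - a) ^ γ)
    (n : ℕ) {p : ℕ → ℝ} (hp : IsPartition s t (n + 1) p) :
    ‖∑ i ∈ Finset.range (n + 1), Ξ (p i) (p (i + 1)) - Ξ s t‖ ≤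
      K * (2 * (t - s)) ^ γ * ∑ k ∈ Finset.range n, ((k : ℝ) + 1) ^ (-γ) := by
  induction n generalizing p with
  | zero =>
    have h0 := hp.1
    have h1 := hp.2.1
    simp only [zero_add] at h1
    simp [h0, h1]
  | succ n ih =>
    obtain ⟨j, hj, hshort⟩ := hp.exists_short
    have hdrop := ih (hp.dropPoint hj)
    rw [sum_dropPoint Ξ p hj] at hdrop
    set S := ∑ i ∈ Finset.range (n + 1 + 1), Ξ (p i) (p (i + 1))
    set D := Ξ (p j) (p (j + 2)) - Ξ (p j) (p (j + 1)) - Ξ (p (j + 1)) (p (j + 2)) with hDdef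
    have hlt1 : p j < p (j + 1) := hp.2.2 j (by omega)
    have hlt2 : p (j + 1) < p (j + 2) := hp.2.2 (j + 1) (by omega)
    have hsj : s ≤ p j := hp.1 ▸ hp.le (Nat.zero_le j) (by omega)
    have hjt : p (j + 2) ≤ t := hp.2.1 ▸ hp.le (show j + 2 ≤ n + 1 + 1 by omega) le_rfl
    have hts : 0 ≤ 2 * (t - s) := by linarith
    have hD : ‖D‖ ≤ K * (2 * (t - s)) ^ γ * ((n : ℝ) + 1) ^ (-γ) := by
      refine (hΞ _ _ _ hsj hlt1 hlt2 hjt).trans ?_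
      rw [mul_assoc, Real.rpow_neg (by positivity), ← div_eq_mul_inv,
        ← Real.div_rpow hts (by positivity)]
      exact mul_le_mul_of_nonneg_left
        (Real.rpow_le_rpow (by linarith) hshort hγ) hK
    rw [Finset.sum_range_succ _ n, mul_add]
    calc ‖S - Ξ s t‖ = ‖(S + D - Ξ s t) - D‖ := by congr 1; abel
      _ ≤ ‖S + D - Ξ s t‖ + ‖D‖ := norm_sub_le _ _
      _ ≤ _ := add_le_add hdrop hD

theorem isPartition_uniform {s t : ℝ} (hst : s < t) (n : ℕ) :
    IsPartition s t (n + 1) fun i => s + i * ((t - s) / (n + 1)) := by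
  refine ⟨by simp, ?_, fun i _ => ?_⟩
  · push_cast
    field_simp
    ring
  · have : 0 < (t - s) / ((n : ℝ) + 1) := div_pos (sub_pos.2 hst) (by positivity)
    push_cast
    linarith

theorem rpow_mul_rpow_le {a b h α β : ℝ} (ha : 0 ≤ a) (hb : 0 ≤ b) (hah : a ≤ h) (hbh : b ≤ h)
    (hα : 0 ≤ α) (hβ : 0 ≤ β) : a ^ α * b ^ β ≤ h ^ (α + β) := by
  rw [Real.rpow_add_of_nonneg (ha.trans hah) hα hβ]
  exact mul_le_mul (Real.rpow_le_rpow ha hah hα) (Real.rpow_le_rpow hb hbh hβ)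
    (Real.rpow_nonneg hb _) (Real.rpow_nonneg (ha.trans hah) _)

theorem IsCRP.norm_deriv_le {V E : Type*} [NormedAddCommGroup V] [NormedSpace ℝ V]
    [NormedAddCommGroup E] [NormedSpace ℝ E] {T α : ℝ} {X : ℝ → V} {Y : ℝ → E}
    {Y' : ℝ → V →L[ℝ] E} (hY : IsCRP T α X Y Y') (hα : 0 ≤ α) {s : ℝ} (hs : 0 ≤ s) (hsT : s ≤ T) :
    ‖Y' s‖ ≤ ‖Y' 0‖ + hnorm T α (fun s t => Y' t - Y' s) * T ^ α := by
  have hn := hnorm_nonneg T α fun s t => Y' t - Y' s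
  rcases hs.eq_or_lt with rfl | hpos
  · exact le_add_of_nonneg_right (mul_nonneg hn (Real.rpow_nonneg hsT _))
  · have h := hY.deriv_hold.le_hnorm le_rfl hpos hsT
    have h2 : s ^ α ≤ T ^ α := Real.rpow_le_rpow hs hsT hα
    rw [sub_zero] at h
    calc ‖Y' s‖ = ‖Y' 0 + (Y' s - Y' 0)‖ := by congr 1; abel
      _ ≤ ‖Y' 0‖ + ‖Y' s - Y' 0‖ := norm_add_le _ _
      _ ≤ _ := by gcongr; exact h.trans (mul_le_mul_of_nonneg_left h2 hn)

theorem defect_coeff_le {y yR y1 z zR z1 x xx τ σ : ℝ} (hy : 0 ≤ y) (hyR : 0 ≤ yR)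
    (hy1 : 0 ≤ y1) (hz : 0 ≤ z) (hzR : 0 ≤ zR) (hz1 : 0 ≤ z1) (hx : 0 ≤ x) (hxx : 0 ≤ xx)
    (hτ : 0 ≤ τ) (hσ : 0 ≤ σ) :
    yR * (z + z1 * τ) * x + yR * zR * τ + (y + y1 * τ) * x * zR + (y + y1 * τ) * x ^ 2 * z1 +
        y1 * (z + z1 * τ) * xx + (y + y1 * τ) * z1 * xx ≤
      (1 + τ + σ) * (y + (yR + y1)) * (z + (zR + z1)) * (1 + (x + xx)) ^ 2 := by
  have hY : y + y1 * τ ≤ (1 + τ + σ) * (y + y1) := by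
    rw [← sub_nonneg]; ring_nf; positivity
  have hZ : z + z1 * τ ≤ (1 + τ + σ) * (z + z1) := by
    rw [← sub_nonneg]; ring_nf; positivity
  have hone : τ ≤ 1 + τ + σ := by linarith
  set M := (y + (yR + y1)) * (z + (zR + z1)) with hM
  have hM0 : 0 ≤ M := by positivity
  have h1 : yR * (z + z1) + (y + y1) * zR ≤ M := by
    rw [hM, ← sub_nonneg]; ring_nf; positivity
  have h2 : yR * zR ≤ M := by
    rw [hM, ← sub_nonneg]; ring_nf; positivity
  have h3 : (y + y1) * z1 ≤ M := by
    rw [hM, ← sub_nonneg]; ring_nf; positivity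
  have h4 : y1 * (z + z1) + (y + y1) * z1 ≤ 2 * M := by
    rw [hM, ← sub_nonneg]; ring_nf; positivity
  have h5 : 1 + x + x ^ 2 + 2 * xx ≤ (1 + (x + xx)) ^ 2 := by
    rw [← sub_nonneg]; ring_nf; positivity
  calc
    _ ≤ yR * ((1 + τ + σ) * (z + z1)) * x + yR * zR * (1 + τ + σ) +
        (1 + τ + σ) * (y + y1) * x * zR + (1 + τ + σ) * (y + y1) * x ^ 2 * z1 +
        y1 * ((1 + τ + σ) * (z + z1)) * xx + (1 + τ + σ) * (y + y1) * z1 * xx := by gcongr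
    _ = (1 + τ + σ) * (yR * zR + (yR * (z + z1) + (y + y1) * zR) * x + (y + y1) * z1 * x ^ 2 +
        (y1 * (z + z1) + (y + y1) * z1) * xx) := by ring
    _ ≤ (1 + τ + σ) * (M + M * x + M * x ^ 2 + 2 * M * xx) := by gcongr
    _ = (1 + τ + σ) * M * (1 + x + x ^ 2 + 2 * xx) := by ring
    _ ≤ (1 + τ + σ) * M * (1 + (x + xx)) ^ 2 := by gcongr
    _ = _ := by rw [hM]; ring

section Germ

variable {V V2 W U : Type*}
  [NormedAddCommGroup V] [NormedSpace ℝ V] [NormedAddCommGroup V2] [NormedSpace ℝ V2]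
  [NormedAddCommGroup W] [NormedSpace ℝ W] [NormedAddCommGroup U] [NormedSpace ℝ U]

/-- The germ `Y_s(Z_{s,t}) + (Y'_s ⋆ Z'_s)(𝕏_{s,t})` of the rough integral. -/
noncomputable def germ (tops : TensorOps V V2 W U) (XX : ℝ → ℝ → V2)
    (Y : ℝ → W →L[ℝ] U) (Y' : ℝ → V →L[ℝ] (W →L[ℝ] U))
    (Z : ℝ → W) (Z' : ℝ → V →L[ℝ] W) (s t : ℝ) : U :=
  (Y s) (Z t - Z s) + (tops.spair (Y' s) (Z' s)) (XX s t)

theorem germ_defect (tops : TensorOps V V2 W U) {T α : ℝ} {X : ℝ → V} {XX : ℝ → ℝ → V2}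
    (hX : IsRoughPath T α tops.tmul X XX)
    (Y : ℝ → W →L[ℝ] U) (Y' : ℝ → V →L[ℝ] (W →L[ℝ] U)) (Z : ℝ → W) (Z' : ℝ → V →L[ℝ] W)
    {s u t : ℝ} (hs : 0 ≤ s) (hsu : s ≤ u) (hut : u ≤ t) (ht : t ≤ T) :
    germ tops XX Y Y' Z Z' s t - germ tops XX Y Y' Z Z' s u - germ tops XX Y Y' Z Z' u t =
      -(Rem X Y Y' s u (Z' u (X t - X u)) + Rem X Y Y' s u (Rem X Z Z' u t) +
        Y' s (X u - X s) (Rem X Z Z' u t) + Y' s (X u - X s) ((Z' u - Z' s) (X t - X u)) +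
        tops.spair (Y' u - Y' s) (Z' u) (XX u t) + tops.spair (Y' s) (Z' u - Z' s) (XX u t)) := by
  simp only [germ, Rem, hX.chen s u t hs hsu hut ht, map_add, map_sub, tops.spair_tmul,
    sub_apply]
  abel

theorem germ_defect_bound (tops : TensorOps V V2 W U) {T α : ℝ} (hα : 0 ≤ α)
    {X : ℝ → V} {XX : ℝ → ℝ → V2} (hX : IsRoughPath T α tops.tmul X XX)
    {Y : ℝ → W →L[ℝ] U} {Y' : ℝ → V →L[ℝ] (W →L[ℝ] U)} (hY : IsCRP T α X Y Y')
    {Z : ℝ → W} {Z' : ℝ → V →L[ℝ] W} (hZ : IsCRP T α X Z Z')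
    {s u t : ℝ} (hs : 0 ≤ s) (hsu : s < u) (hut : u < t) (ht : t ≤ T) :
    ‖germ tops XX Y Y' Z Z' s t - germ tops XX Y Y' Z Z' s u - germ tops XX Y Y' Z Z' u t‖ ≤
      (1 + T ^ α + T ^ (2 * α)) * (‖Y' 0‖ + crpNorm T α X Y Y') *
        (‖Z' 0‖ + crpNorm T α X Z Z') * (1 + rpNorm T α X XX) ^ 2 * (t - s) ^ (3 * α) := by
  have hu : 0 ≤ u := hs.trans hsu.le
  have huT : u ≤ T := hut.le.trans ht
  have hT : 0 ≤ T := hu.trans huT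
  have bX1 := hX.x_hold.le_hnorm hs hsu huT
  have bX2 := hX.x_hold.le_hnorm hu hut ht
  have bXX := hX.xx_hold.le_hnorm hu hut ht
  have bY := hY.rem_hold.le_hnorm hs hsu huT
  have bZ := hZ.rem_hold.le_hnorm hu hut ht
  have bY1 := hY.deriv_hold.le_hnorm hs hsu huT
  have bZ1 := hZ.deriv_hold.le_hnorm hs hsu huT
  have bYs := hY.norm_deriv_le hα hs (hsu.le.trans huT)
  have bZu := hZ.norm_deriv_le hα hu huT
  rw [germ_defect tops hX Y Y' Z Z' hs hsu.le hut.le ht, norm_neg]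
  simp only [crpNorm, rpNorm]
  have nx := hnorm_nonneg T α fun s t => X t - X s
  have nxx := hnorm_nonneg T (2 * α) XX
  have nyR := hnorm_nonneg T (2 * α) (Rem X Y Y')
  have nzR := hnorm_nonneg T (2 * α) (Rem X Z Z')
  have ny1 := hnorm_nonneg T α fun s t => Y' t - Y' s
  have nz1 := hnorm_nonneg T α fun s t => Z' t - Z' s
  have ny := norm_nonneg (Y' 0)
  have nz := norm_nonneg (Z' 0)
  set x := hnorm T α fun s t => X t - X s
  set xx := hnorm T (2 * α) XX
  set yR := hnorm T (2 * α) (Rem X Y Y')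
  set zR := hnorm T (2 * α) (Rem X Z Z')
  set y1 := hnorm T α fun s t => Y' t - Y' s
  set z1 := hnorm T α fun s t => Z' t - Z' s
  set y := ‖Y' 0‖
  set z := ‖Z' 0‖
  have nτ : 0 ≤ T ^ α := Real.rpow_nonneg hT _
  have nτ2 : 0 ≤ T ^ (2 * α) := Real.rpow_nonneg hT _
  have ha : 0 ≤ u - s := (sub_pos.2 hsu).le
  have hb : 0 ≤ t - u := (sub_pos.2 hut).le
  have nH : 0 ≤ (t - s) ^ (3 * α) := Real.rpow_nonneg (by linarith) _
  have e21 : (u - s) ^ (2 * α) * (t - u) ^ α ≤ (t - s) ^ (3 * α) := by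
    convert rpow_mul_rpow_le (h := t - s) ha hb (by linarith) (by linarith)
      (by positivity : 0 ≤ 2 * α) hα using 2
    ring
  have e12 : (u - s) ^ α * (t - u) ^ (2 * α) ≤ (t - s) ^ (3 * α) := by
    convert rpow_mul_rpow_le (h := t - s) ha hb (by linarith) (by linarith) hα
      (by positivity : 0 ≤ 2 * α) using 2
    ring
  have hbb : (t - u) ^ (2 * α) ≤ T ^ α * (t - u) ^ α := by
    rw [two_mul, Real.rpow_add_of_nonneg hb hα hα]
    gcongr
    linarith
  have haa : (u - s) ^ (2 * α) = (u - s) ^ α * (u - s) ^ α := by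
    rw [two_mul, Real.rpow_add_of_nonneg ha hα hα]
  have na := Real.rpow_nonneg ha α
  have nb := Real.rpow_nonneg hb α
  have naa := Real.rpow_nonneg ha (2 * α)
  have nbb := Real.rpow_nonneg hb (2 * α)
  set A := (u - s) ^ α
  set B := (t - u) ^ α
  set A2 := (u - s) ^ (2 * α)
  set B2 := (t - u) ^ (2 * α)
  set H := (t - s) ^ (3 * α)
  set τ := T ^ α
  have t1 : ‖Rem X Y Y' s u (Z' u (X t - X u))‖ ≤ yR * (z + z1 * τ) * x * H := by
    calc _ ≤ ‖Rem X Y Y' s u‖ * (‖Z' u‖ * ‖X t - X u‖) :=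
          ContinuousLinearMap.le_opNorm_of_le _ (ContinuousLinearMap.le_opNorm _ _)
      _ ≤ (yR * A2) * ((z + z1 * τ) * (x * B)) := by gcongr
      _ = yR * (z + z1 * τ) * x * (A2 * B) := by ring
      _ ≤ _ := by gcongr
  have t2 : ‖Rem X Y Y' s u (Rem X Z Z' u t)‖ ≤ yR * zR * τ * H := by
    calc _ ≤ ‖Rem X Y Y' s u‖ * ‖Rem X Z Z' u t‖ := ContinuousLinearMap.le_opNorm _ _
      _ ≤ (yR * A2) * (zR * (τ * B)) := by
          gcongr
          exact bZ.trans (mul_le_mul_of_nonneg_left hbb nzR)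
      _ = yR * zR * τ * (A2 * B) := by ring
      _ ≤ _ := by gcongr
  have t3 : ‖Y' s (X u - X s) (Rem X Z Z' u t)‖ ≤ (y + y1 * τ) * x * zR * H := by
    calc _ ≤ ‖Y' s‖ * ‖X u - X s‖ * ‖Rem X Z Z' u t‖ := ContinuousLinearMap.le_opNorm₂ _ _ _
      _ ≤ (y + y1 * τ) * (x * A) * (zR * B2) := by gcongr
      _ = (y + y1 * τ) * x * zR * (A * B2) := by ring
      _ ≤ _ := by gcongr
  have t4 : ‖Y' s (X u - X s) ((Z' u - Z' s) (X t - X u))‖ ≤ (y + y1 * τ) * x ^ 2 * z1 * H := by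
    calc _ ≤ ‖Y' s‖ * ‖X u - X s‖ * ‖(Z' u - Z' s) (X t - X u)‖ :=
          ContinuousLinearMap.le_opNorm₂ _ _ _
      _ ≤ ‖Y' s‖ * ‖X u - X s‖ * (‖Z' u - Z' s‖ * ‖X t - X u‖) := by
          gcongr
          exact ContinuousLinearMap.le_opNorm _ _
      _ ≤ (y + y1 * τ) * (x * A) * ((z1 * A) * (x * B)) := by gcongr
      _ = (y + y1 * τ) * x ^ 2 * z1 * (A2 * B) := by rw [haa]; ring
      _ ≤ _ := by gcongr
  have t5 : ‖tops.spair (Y' u - Y' s) (Z' u) (XX u t)‖ ≤ y1 * (z + z1 * τ) * xx * H := by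
    calc _ ≤ ‖Y' u - Y' s‖ * ‖Z' u‖ * ‖XX u t‖ :=
          ContinuousLinearMap.le_of_opNorm_le _ (tops.spair_le _ _) _
      _ ≤ (y1 * A) * (z + z1 * τ) * (xx * B2) := by gcongr
      _ = y1 * (z + z1 * τ) * xx * (A * B2) := by ring
      _ ≤ _ := by gcongr
  have t6 : ‖tops.spair (Y' s) (Z' u - Z' s) (XX u t)‖ ≤ (y + y1 * τ) * z1 * xx * H := by
    calc _ ≤ ‖Y' s‖ * ‖Z' u - Z' s‖ * ‖XX u t‖ :=
          ContinuousLinearMap.le_of_opNorm_le _ (tops.spair_le _ _) _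
      _ ≤ (y + y1 * τ) * (z1 * A) * (xx * B2) := by gcongr
      _ = (y + y1 * τ) * z1 * xx * (A * B2) := by ring
      _ ≤ _ := by gcongr
  refine (norm_add_le_of_le (norm_add_le_of_le (norm_add_le_of_le (norm_add_le_of_le
    (norm_add_le_of_le t1 t2) t3) t4) t5) t6).trans ?_
  rw [← add_mul, ← add_mul, ← add_mul, ← add_mul, ← add_mul]
  refine mul_le_mul_of_nonneg_right ?_ nH
  exact defect_coeff_le ny nyR ny1 nz nzR nz1 nx nxx nτ nτ2

end Germ

/-- a priori estimate for the rough integral. -/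
theorem stmt5
    {V V2 W U : Type*} [NormedAddCommGroup V] [NormedSpace ℝ V] [CompleteSpace V]
    [NormedAddCommGroup V2] [NormedSpace ℝ V2] [CompleteSpace V2]
    [NormedAddCommGroup W] [NormedSpace ℝ W] [CompleteSpace W]
    [NormedAddCommGroup U] [NormedSpace ℝ U] [CompleteSpace U]
    (T α : ℝ) (hT : 0 < T) (hα : 1 / 3 < α) (hα' : α ≤ 1 / 2)
    (tops : TensorOps V V2 W U) (X : ℝ → V) (XX : ℝ → ℝ → V2)
    (hX : IsRoughPath T α tops.tmul X XX)
    (Y : ℝ → W →L[ℝ] U) (Y' : ℝ → V →L[ℝ] (W →L[ℝ] U)) (hY : IsCRP T α X Y Y')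
    (Z : ℝ → W) (Z' : ℝ → V →L[ℝ] W) (hZ : IsCRP T α X Z Z')
    (s t : ℝ) (hs : 0 ≤ s) (hst : s ≤ t) (htT : t ≤ T)
    (I : U) (hI : IsRoughIntegral tops XX Y Y' Z Z' s t I) :
    ‖I - (Y s) (Z t - Z s) - (tops.spair (Y' s) (Z' s)) (XX s t)‖ ≤
      Calpha T α * (‖Y' 0‖ + crpNorm T α X Y Y') * (‖Z' 0‖ + crpNorm T α X Z Z') *
        (1 + rpNorm T α X XX) ^ 2 * (t - s) ^ (3 * α) := by
  have hα0 : 0 ≤ α := by linarith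
  have hnY : 0 ≤ crpNorm T α X Y Y' := add_nonneg (hnorm_nonneg _ _ _) (hnorm_nonneg _ _ _)
  have hnZ : 0 ≤ crpNorm T α X Z Z' := add_nonneg (hnorm_nonneg _ _ _) (hnorm_nonneg _ _ _)
  rw [sub_sub]
  change ‖I - germ tops XX Y Y' Z Z' s t‖ ≤ _
  rcases hst.eq_or_lt with rfl | hlt
  · have hXX : XX s s = 0 := by
      have h := hX.chen s s s hs le_rfl le_rfl htT
      simpa using h
    have hI0 : ‖I‖ ≤ 0 := by
      refine le_of_forall_pos_le_add fun ε hε => ?_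
      obtain ⟨δ, -, h⟩ := hI ε hε
      have h := h 0 (fun _ => s) ⟨rfl, rfl, by simp⟩ (by simp)
      simpa [rsum] using h
    rw [norm_le_zero_iff] at hI0
    have hne : 3 * α ≠ 0 := by linarith
    simp [germ, hXX, hI0, Real.zero_rpow hne]
  · set K := (1 + T ^ α + T ^ (2 * α)) * (‖Y' 0‖ + crpNorm T α X Y Y') *
      (‖Z' 0‖ + crpNorm T α X Z Z') * (1 + rpNorm T α X XX) ^ 2 with hKdef
    have hK : 0 ≤ K := by positivity
    have hsummable : Summable fun n : ℕ => ((n : ℝ) + 1) ^ (-(3 * α)) := by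
      have h := (summable_nat_add_iff 1).2
        (Real.summable_nat_rpow.2 (show -(3 * α) < -1 by linarith))
      simpa using h
    have hbound : Calpha T α * (‖Y' 0‖ + crpNorm T α X Y Y') * (‖Z' 0‖ + crpNorm T α X Z Z') *
        (1 + rpNorm T α X XX) ^ 2 * (t - s) ^ (3 * α) =
        K * (2 * (t - s)) ^ (3 * α) * ∑' n : ℕ, ((n : ℝ) + 1) ^ (-(3 * α)) := by
      rw [Real.mul_rpow zero_le_two (sub_pos.2 hlt).le, Calpha, hKdef]
      ring
    rw [hbound]
    refine le_of_forall_pos_le_add fun ε hε => ?_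
    obtain ⟨δ, hδ, hmesh⟩ := hI ε hε
    obtain ⟨n, hn⟩ := exists_nat_gt ((t - s) / δ)
    have hp := isPartition_uniform hlt n
    have happrox := hmesh (n + 1) _ hp fun i _ => by
      push_cast
      have h : (t - s) / ((n : ℝ) + 1) < δ := by
        rw [div_lt_iff₀ hδ] at hn
        rw [div_lt_iff₀ (by positivity)]
        nlinarith
      linarith
    have hsum := norm_partition_sum_sub_le hK (by positivity : 0 ≤ 3 * α)
      (fun a b c ha hab hbc hc =>
        germ_defect_bound tops hα0 hX hY hZ (hs.trans ha) hab hbc (hc.trans htT)) n hp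
    have htail := hsummable.sum_le_tsum (Finset.range n) fun k _ => by positivity
    have hpos : 0 ≤ K * (2 * (t - s)) ^ (3 * α) :=
      mul_nonneg hK (Real.rpow_nonneg (by linarith) _)
    have htri := norm_sub_le_norm_sub_add_norm_sub I
      (rsum tops XX Y Y' Z Z' (n + 1) fun i => s + i * ((t - s) / (n + 1)))
      (germ tops XX Y Y' Z Z' s t)
    rw [norm_sub_rev I (rsum _ _ _ _ _ _ _ _)] at htri
    have hsum' := hsum.trans (mul_le_mul_of_nonneg_left htail hpos)
    exact htri.trans ((add_le_add happrox hsum').trans_eq (add_comm _ _))
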